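/- arXiv:2205.06650 — 4 statements merged into one kernel-verified Lean document; each statement's English description precedes it below -/
import Mathlib

section
/- (Theorem 1, forward direction.) Let (k, X, Ω, K, 𝒜, S) be an instance of weight-constrained anisotropic assignment and let C ∈ C_K(k,X,Ω). If C minimizes cost_{𝒜,S}(X,·) over C_K(k,X,Ω), then there exist size parameters Γ = (γ_1,…,γ_k) ∈ ℝ^k such that C and the anisotropic power diagram P(𝒜,S,Γ) are compatible. -/
open Matrix BigOperators

/-- The ellipsoidal norm `‖x‖_A := √(xᵀAx)`. -/
noncomputable def ellipNorm {d : ℕ} (A : Matrix (Fin d) (Fin d) ℝ) (x : Fin d → ℝ) : ℝ :=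
  Real.sqrt (x ⬝ᵥ A.mulVec x)

/-- A weight-constrained clustering (the set of all of them is `C_K(k,X,Ω)`). -/
def IsClustering {k n : ℕ} (ω : Fin n → ℝ) (κ : Fin k → ℝ) (ξ : Fin k → Fin n → ℝ) : Prop :=
  (∀ i j, 0 ≤ ξ i j) ∧ (∀ j, ∑ i, ξ i j = 1) ∧ (∀ i, ∑ j, ξ i j * ω j = κ i)

/-- The cost `cost_{𝒜,S}(X,C) = Σ_i Σ_j ξ_{ij} ω_j ‖x_j − s_i‖_{A_i}²`. -/
noncomputable def clusterCost {d k n : ℕ} (A : Fin k → Matrix (Fin d) (Fin d) ℝ)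
    (s : Fin k → Fin d → ℝ) (x : Fin n → Fin d → ℝ) (ω : Fin n → ℝ)
    (ξ : Fin k → Fin n → ℝ) : ℝ :=
  ∑ i, ∑ j, ξ i j * ω j * ellipNorm (A i) (x j - s i) ^ 2

/-- The cell `P_i` of the anisotropic power diagram `P(𝒜,S,Γ)`. -/
def APDcell {d k : ℕ} (A : Fin k → Matrix (Fin d) (Fin d) ℝ)
    (s : Fin k → Fin d → ℝ) (γ : Fin k → ℝ) (i : Fin k) : Set (Fin d → ℝ) :=
  {x | ∀ l, ellipNorm (A i) (x - s i) ^ 2 + γ i ≤ ellipNorm (A l) (x - s l) ^ 2 + γ l}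

section Transfer

variable {ι τ : Type*} [Fintype ι] [Fintype τ]

/-- The linear cost `Σ_i Σ_j D_{ij} ω_j c_{ij}` of a (signed) assignment `D`. -/
noncomputable def linearCost (c : ι → τ → ℝ) (ω : τ → ℝ) (D : ι → τ → ℝ) : ℝ :=
  ∑ i, ∑ j, D i j * ω j * c i j

theorem linearCost_add (c : ι → τ → ℝ) (ω : τ → ℝ) (D E : ι → τ → ℝ) :
    linearCost c ω (D + E) = linearCost c ω D + linearCost c ω E := by
  simp only [linearCost, Pi.add_apply, add_mul, Finset.sum_add_distrib]

theorem linearCost_smul (c : ι → τ → ℝ) (ω : τ → ℝ) (ε : ℝ) (D : ι → τ → ℝ) :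
    linearCost c ω (ε • D) = ε * linearCost c ω D := by
  simp only [linearCost, Pi.smul_apply, smul_eq_mul, mul_assoc, Finset.mul_sum]

variable [DecidableEq ι]

/-- `D` is a direction that moves one unit of weight from cluster `a` to cluster `b`, keeps the
assignment of every point complete, and never decreases a vanishing entry of `ξ`. -/
structure IsTransfer (ξ : ι → τ → ℝ) (ω : τ → ℝ) (a b : ι) (D : ι → τ → ℝ) : Prop where
  nonneg : ∀ i j, ξ i j = 0 → 0 ≤ D i j
  sum_eq_zero : ∀ j, ∑ i, D i j = 0
  sum_mul : ∀ i, ∑ j, D i j * ω j = (Pi.single b 1 - Pi.single a 1 : ι → ℝ) i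

theorem IsTransfer.add {ξ : ι → τ → ℝ} {ω : τ → ℝ} {a b e : ι} {D E : ι → τ → ℝ}
    (hD : IsTransfer ξ ω a b D) (hE : IsTransfer ξ ω b e E) : IsTransfer ξ ω a e (D + E) where
  nonneg i j h := add_nonneg (hD.nonneg i j h) (hE.nonneg i j h)
  sum_eq_zero j := by
    simp [Finset.sum_add_distrib, hD.sum_eq_zero j, hE.sum_eq_zero j]
  sum_mul i := by
    simp only [Pi.add_apply, add_mul, Finset.sum_add_distrib, hD.sum_mul i, hE.sum_mul i,
      Pi.sub_apply]
    ring

/-- Moving a unit of weight of a single point `j` from `a` to `b`. -/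
theorem exists_isTransfer_of_pos [DecidableEq τ] (c : ι → τ → ℝ) {ξ : ι → τ → ℝ} {ω : τ → ℝ}
    (hω : ∀ j, 0 < ω j) {a : ι} {j : τ} (h : 0 < ξ a j) (b : ι) :
    ∃ D, IsTransfer ξ ω a b D ∧ linearCost c ω D = c b j - c a j := by
  have hj := (hω j).ne'
  refine ⟨fun i ↦ Pi.single j ((Pi.single b 1 - Pi.single a 1 : ι → ℝ) i / ω j),
    ⟨fun i j' h0 ↦ ?_, fun j' ↦ ?_, fun i ↦ ?_⟩, ?_⟩
  · obtain rfl | hne := eq_or_ne j' j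
    · have hia : i ≠ a := by rintro rfl; exact h.ne' h0
      simp only [Pi.single_eq_same, Pi.sub_apply, Pi.single_eq_of_ne hia, sub_zero]
      refine div_nonneg ?_ (hω j').le
      obtain rfl | hb := eq_or_ne i b <;> simp [*]
    · simp [hne]
  · obtain rfl | hne := eq_or_ne j' j
    · simp [← Finset.sum_div]
    · simp [hne]
  · rw [Finset.sum_eq_single j (by simp +contextual) (by simp)]
    simp [hj]
  · have hrow (i : ι) : ∑ j', (Pi.single j ((Pi.single b 1 - Pi.single a 1 : ι → ℝ) i / ω j) :
        τ → ℝ) j' * ω j' * c i j' = (Pi.single b 1 - Pi.single a 1 : ι → ℝ) i * c i j := by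
      rw [Finset.sum_eq_single j (by simp +contextual) (by simp)]
      simp [hj]
    simp only [linearCost, hrow]
    simp [sub_mul, Pi.single_apply]

/-- Along a closed transfer, the cost cannot decrease from a minimizer. -/
theorem IsTransfer.linearCost_nonneg {c ξ : ι → τ → ℝ} {ω : τ → ℝ}
    (hξ : ∀ i j, 0 ≤ ξ i j)
    (hopt : ∀ ξ' : ι → τ → ℝ, (∀ i j, 0 ≤ ξ' i j) → (∀ j, ∑ i, ξ' i j = ∑ i, ξ i j) →
      (∀ i, ∑ j, ξ' i j * ω j = ∑ j, ξ i j * ω j) → linearCost c ω ξ ≤ linearCost c ω ξ')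
    {a : ι} {D : ι → τ → ℝ} (hD : IsTransfer ξ ω a a D) : 0 ≤ linearCost c ω D := by
  have hsmall : ∀ᶠ ε : ℝ in nhdsWithin 0 (Set.Ioi 0), ∀ i j, 0 ≤ ξ i j + ε * D i j := by
    simp only [Filter.eventually_all]
    intro i j
    obtain h0 | hpos := (hξ i j).eq_or_lt
    · filter_upwards [self_mem_nhdsWithin] with ε hε
      rw [← h0, zero_add]
      exact mul_nonneg (le_of_lt hε) (hD.nonneg i j h0.symm)
    · have hcont : Filter.Tendsto (fun ε : ℝ ↦ ξ i j + ε * D i j) (nhds 0) (nhds (ξ i j)) := by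
        have : Continuous fun ε : ℝ ↦ ξ i j + ε * D i j := by fun_prop
        simpa using this.tendsto 0
      filter_upwards [(hcont.mono_left nhdsWithin_le_nhds).eventually_const_lt hpos] with ε hε
      exact hε.le
  obtain ⟨ε, hε, hε0⟩ := (hsmall.and self_mem_nhdsWithin).exists
  have hle := hopt (ξ + ε • D) hε
    (fun j ↦ by
      simp [Finset.sum_add_distrib, ← Finset.mul_sum, hD.sum_eq_zero j])
    (fun i ↦ by
      simp [add_mul, Finset.sum_add_distrib, mul_assoc, ← Finset.mul_sum, hD.sum_mul i])
  rw [linearCost_add, linearCost_smul] at hle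
  exact nonneg_of_mul_nonneg_right (by linarith) hε0

/-- Dual potentials for a minimizer, on the clusters of nonzero weight. -/
theorem exists_potential_of_pos {c ξ : ι → τ → ℝ} {ω : τ → ℝ} (hω : ∀ j, 0 < ω j)
    (hξ : ∀ i j, 0 ≤ ξ i j)
    (hopt : ∀ ξ' : ι → τ → ℝ, (∀ i j, 0 ≤ ξ' i j) → (∀ j, ∑ i, ξ' i j = ∑ i, ξ i j) →
      (∀ i, ∑ j, ξ' i j * ω j = ∑ j, ξ i j * ω j) → linearCost c ω ξ ≤ linearCost c ω ξ') :
    ∃ g : ι → ℝ, ∀ i j l j', 0 < ξ i j → 0 < ξ l j' → g i + c i j ≤ g l + c l j := by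
  classical
  by_cases hne : ∃ a j, 0 < ξ a j
  · obtain ⟨a, ja, ha⟩ := hne
    let costs (i : ι) : Set ℝ := linearCost c ω '' {D | IsTransfer ξ ω i a D}
    have hbdd (i : ι) : BddBelow (costs i) := by
      obtain ⟨E, hE, -⟩ := exists_isTransfer_of_pos c hω ha i
      refine ⟨-linearCost c ω E, ?_⟩
      rintro _ ⟨D, hD, rfl⟩
      have := (hE.add hD).linearCost_nonneg hξ hopt
      rw [linearCost_add] at this
      linarith
    refine ⟨fun i ↦ sInf (costs i), fun i j l j' hi hl ↦ ?_⟩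
    have hnonempty : (costs l).Nonempty := by
      obtain ⟨E, hE, -⟩ := exists_isTransfer_of_pos c hω hl a
      exact ⟨_, E, hE, rfl⟩
    have : sInf (costs i) - (c l j - c i j) ≤ sInf (costs l) := by
      refine le_csInf hnonempty ?_
      rintro _ ⟨D, hD, rfl⟩
      obtain ⟨E, hE, hEc⟩ := exists_isTransfer_of_pos c hω hi l
      have := csInf_le (hbdd i) ⟨E + D, hE.add hD, rfl⟩
      rw [linearCost_add, hEc] at this
      linarith
    linarith
  · exact ⟨0, fun i j _ _ hi ↦ absurd ⟨i, j, hi⟩ hne⟩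

/-- Dual potentials for a minimizer of the transportation problem. -/
theorem exists_potential {c ξ : ι → τ → ℝ} {ω : τ → ℝ} (hω : ∀ j, 0 < ω j)
    (hξ : ∀ i j, 0 ≤ ξ i j)
    (hopt : ∀ ξ' : ι → τ → ℝ, (∀ i j, 0 ≤ ξ' i j) → (∀ j, ∑ i, ξ' i j = ∑ i, ξ i j) →
      (∀ i, ∑ j, ξ' i j * ω j = ∑ j, ξ i j * ω j) → linearCost c ω ξ ≤ linearCost c ω ξ') :
    ∃ γ : ι → ℝ, ∀ i j l, 0 < ξ i j → c i j + γ i ≤ c l j + γ l := by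
  obtain ⟨g, hg⟩ := exists_potential_of_pos hω hξ hopt
  let bound (l : ι) (p : {p : ι × τ // 0 < ξ p.1 p.2}) : ℝ := g p.1.1 + c p.1.1 p.1.2 - c l p.1.2
  refine ⟨fun l ↦ ⨆ p, bound l p, fun i j l hij ↦ ?_⟩
  let q : {p : ι × τ // 0 < ξ p.1 p.2} := ⟨(i, j), hij⟩
  have : Nonempty {p : ι × τ // 0 < ξ p.1 p.2} := ⟨q⟩
  have hupper : ⨆ p, bound i p ≤ g i :=
    ciSup_le fun p ↦ sub_le_iff_le_add.2 (hg p.1.1 p.1.2 i j p.2 hij)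
  have hlower : g i + c i j - c l j ≤ ⨆ p, bound l p :=
    le_ciSup (Set.finite_range (bound l)).bddAbove q
  linarith

end Transfer

/-- (Theorem 1, forward direction.)  If `C ∈ C_K(k,X,Ω)` minimizes `cost_{𝒜,S}(X,·)`
over `C_K(k,X,Ω)`, then there exist sizes `Γ` such that `C` and the anisotropic power
diagram `P(𝒜,S,Γ)` are compatible, i.e. every point `x_j` with `ξ_{ij} > 0`
lies in the cell `P_i`. -/
theorem optimal_clustering_admits_compatible_APD {d k n : ℕ}
    (A : Fin k → Matrix (Fin d) (Fin d) ℝ) (hA : ∀ i, (A i).PosDef)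
    (s : Fin k → Fin d → ℝ) (hs : Function.Injective s)
    (x : Fin n → Fin d → ℝ) (ω : Fin n → ℝ) (hω : ∀ j, 0 < ω j) (κ : Fin k → ℝ)
    (ξ : Fin k → Fin n → ℝ) (hξ : IsClustering ω κ ξ)
    (hopt : ∀ ξ' : Fin k → Fin n → ℝ, IsClustering ω κ ξ' →
      clusterCost A s x ω ξ ≤ clusterCost A s x ω ξ') :
    ∃ γ : Fin k → ℝ, ∀ (i : Fin k) (j : Fin n), 0 < ξ i j → x j ∈ APDcell A s γ i := by
  obtain ⟨hnonneg, hsum, hweight⟩ := hξ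
  obtain ⟨γ, hγ⟩ := exists_potential (c := fun i j ↦ ellipNorm (A i) (x j - s i) ^ 2) hω hnonneg
    fun ξ' h0 h1 h2 ↦ hopt ξ' ⟨h0, fun j ↦ (h1 j).trans (hsum j), fun i ↦ (h2 i).trans (hweight i)⟩
  exact ⟨γ, fun i j hij l ↦ hγ i j l hij⟩
end

section
/- (Theorem 1, backward direction.) Let (k, X, Ω, K, 𝒜, S) be an instance of weight-constrained anisotropic assignment and let C ∈ C_K(k,X,Ω). If there exist size parameters Γ = (γ_1,…,γ_k) ∈ ℝ^k such that C and the anisotropic power diagram P(𝒜,S,Γ) are compatible, then C minimizes cost_{𝒜,S}(X,·) over C_K(k,X,Ω). -/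
open Matrix BigOperators

/-- A probability vector supported on minimizers of `c` has the smallest average of `c`. -/
theorem sum_mul_le_sum_mul_of_support_minimizers {ι : Type*} [Fintype ι] (p q c : ι → ℝ)
    (hp : ∀ i, 0 ≤ p i) (hq : ∀ i, 0 ≤ q i) (hp1 : ∑ i, p i = 1) (hq1 : ∑ i, q i = 1)
    (hmin : ∀ i, 0 < p i → ∀ l, c i ≤ c l) :
    ∑ i, p i * c i ≤ ∑ l, q l * c l := by
  calc ∑ i, p i * c i = ∑ i, ∑ l, p i * (q l * c i) := by
        simp_rw [← Finset.mul_sum, ← Finset.sum_mul, hq1, one_mul]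
    _ ≤ ∑ i, ∑ l, p i * (q l * c l) := by
        refine Finset.sum_le_sum fun i _ => Finset.sum_le_sum fun l _ => ?_
        rcases (hp i).eq_or_lt with h | h
        · simp [← h]
        · exact mul_le_mul_of_nonneg_left
            (mul_le_mul_of_nonneg_left (hmin i h l) (hq l)) (hp i)
    _ = ∑ l, q l * c l := by
        simp_rw [← Finset.mul_sum, ← Finset.sum_mul, hp1, one_mul]

/-- On weight-constrained clusterings, adding sizes `γ` to the squared distances shifts the cost
by the constant `∑ i, γ i * κ i`. -/
theorem clusterCost_add_sum_mul {d k n : ℕ} (A : Fin k → Matrix (Fin d) (Fin d) ℝ)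
    (s : Fin k → Fin d → ℝ) (x : Fin n → Fin d → ℝ) (ω : Fin n → ℝ) (κ : Fin k → ℝ)
    (γ : Fin k → ℝ) (ξ : Fin k → Fin n → ℝ) (hξ : IsClustering ω κ ξ) :
    clusterCost A s x ω ξ + ∑ i, γ i * κ i =
      ∑ j, ω j * ∑ i, ξ i j * (ellipNorm (A i) (x j - s i) ^ 2 + γ i) := by
  simp_rw [clusterCost, ← hξ.2.2, Finset.mul_sum]
  rw [Finset.sum_comm (s := (Finset.univ : Finset (Fin n))), ← Finset.sum_add_distrib]
  refine Finset.sum_congr rfl fun i _ => ?_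
  rw [← Finset.sum_add_distrib]
  exact Finset.sum_congr rfl fun j _ => by ring

/-- (Theorem 1, backward direction.)  If there exist sizes `Γ` such that
`C ∈ C_K(k,X,Ω)` and the anisotropic power diagram `P(𝒜,S,Γ)` are compatible
(every point `x_j` with `ξ_{ij} > 0` lies in the cell `P_i`), then `C` minimizes
`cost_{𝒜,S}(X,·)` over `C_K(k,X,Ω)`. -/
theorem compatible_APD_implies_optimal_clustering {d k n : ℕ}
    (A : Fin k → Matrix (Fin d) (Fin d) ℝ) (hA : ∀ i, (A i).PosDef)
    (s : Fin k → Fin d → ℝ) (hs : Function.Injective s)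
    (x : Fin n → Fin d → ℝ) (ω : Fin n → ℝ) (hω : ∀ j, 0 < ω j) (κ : Fin k → ℝ)
    (ξ : Fin k → Fin n → ℝ) (hξ : IsClustering ω κ ξ)
    (hcomp : ∃ γ : Fin k → ℝ, ∀ (i : Fin k) (j : Fin n), 0 < ξ i j → x j ∈ APDcell A s γ i) :
    ∀ ξ' : Fin k → Fin n → ℝ, IsClustering ω κ ξ' →
      clusterCost A s x ω ξ ≤ clusterCost A s x ω ξ' := by
  intro ξ' hξ'
  obtain ⟨γ, hγ⟩ := hcomp
  rw [← add_le_add_iff_right (∑ i, γ i * κ i), clusterCost_add_sum_mul A s x ω κ γ ξ hξ,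
    clusterCost_add_sum_mul A s x ω κ γ ξ' hξ']
  refine Finset.sum_le_sum fun j _ => mul_le_mul_of_nonneg_left ?_ (hω j).le
  exact sum_mul_le_sum_mul_of_support_minimizers (fun i => ξ i j) (fun i => ξ' i j)
    (fun i => ellipNorm (A i) (x j - s i) ^ 2 + γ i) (fun i => hξ.1 i j) (fun i => hξ'.1 i j)
    (hξ.2.1 j) (hξ'.2.1 j) (fun i hi => hγ i j hi)
end

section
/- (Complementary slackness yields compatibility.) Let (ξ_{ij}) ∈ C_K(k,X,Ω) be feasible for the primal (P) and let (η_1,…,η_n, γ_1,…,γ_k) be feasible for the dual (D), and suppose their objective values are equal: Σ_{i,j} ξ_{ij} ω_j ‖x_j − s_i‖_{A_i}² = Σ_j ω_j η_j − Σ_i κ_i γ_i. Then for all i ∈ [k] and j ∈ [n] with ξ_{ij} > 0 one has η_j = ‖x_j − s_i‖_{A_i}² + γ_i, and consequently ‖x_j − s_i‖_{A_i}² + γ_i ≤ ‖x_j − s_ℓ‖_{A_ℓ}² + γ_ℓ for all ℓ ∈ [k]; that is, x_j lies in the cell P_i of the anisotropic power diagram P(𝒜,S,Γ), so the clustering and the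 diagram are compatible. -/
open Matrix BigOperators

/-- Feasibility for the dual LP (D). -/
def DualFeasible {d k n : ℕ} (A : Fin k → Matrix (Fin d) (Fin d) ℝ)
    (s : Fin k → Fin d → ℝ) (x : Fin n → Fin d → ℝ)
    (η : Fin n → ℝ) (γ : Fin k → ℝ) : Prop :=
  ∀ (i : Fin k) (j : Fin n), η j ≤ ellipNorm (A i) (x j - s i) ^ 2 + γ i

/-- The duality gap is the weighted sum of the slacks of the dual constraints. -/
lemma IsClustering.clusterCost_sub_dual_eq_sum_slack {d k n : ℕ}
    {ω : Fin n → ℝ} {κ : Fin k → ℝ} {ξ : Fin k → Fin n → ℝ} (hξ : IsClustering ω κ ξ)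
    (A : Fin k → Matrix (Fin d) (Fin d) ℝ) (s : Fin k → Fin d → ℝ) (x : Fin n → Fin d → ℝ)
    (η : Fin n → ℝ) (γ : Fin k → ℝ) :
    clusterCost A s x ω ξ - (∑ j, ω j * η j - ∑ i, κ i * γ i) =
      ∑ i, ∑ j, ξ i j * ω j * (ellipNorm (A i) (x j - s i) ^ 2 + γ i - η j) := by
  obtain ⟨-, hcol, hrow⟩ := hξ
  have hη : ∑ j, ω j * η j = ∑ i, ∑ j, ξ i j * ω j * η j := by
    rw [Finset.sum_comm]
    refine Finset.sum_congr rfl fun j _ => ?_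
    simp only [mul_assoc]
    rw [← Finset.sum_mul, hcol, one_mul]
  have hγ : ∑ i, κ i * γ i = ∑ i, ∑ j, ξ i j * ω j * γ i :=
    Finset.sum_congr rfl fun i _ => by rw [← hrow, Finset.sum_mul]
  rw [hη, hγ, clusterCost]
  simp only [mul_sub, mul_add, Finset.sum_sub_distrib, Finset.sum_add_distrib]
  ring

/-- (Complementary slackness yields compatibility.)  If `ξ ∈ C_K(k,X,Ω)` is primal
feasible, `(η,γ)` is dual feasible, and the objective values agree, then for all `i, j`
with `ξ_{ij} > 0` one has `η_j = ‖x_j − s_i‖_{A_i}² + γ_i`, and consequently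
`x_j` lies in the cell `P_i` of `P(𝒜,S,Γ)`; hence clustering and diagram are
compatible. -/
theorem complementary_slackness_compatibility {d k n : ℕ}
    (A : Fin k → Matrix (Fin d) (Fin d) ℝ) (hA : ∀ i, (A i).PosDef)
    (s : Fin k → Fin d → ℝ) (hs : Function.Injective s)
    (x : Fin n → Fin d → ℝ) (ω : Fin n → ℝ) (hω : ∀ j, 0 < ω j) (κ : Fin k → ℝ)
    (ξ : Fin k → Fin n → ℝ) (hξ : IsClustering ω κ ξ)
    (η : Fin n → ℝ) (γ : Fin k → ℝ) (hηγ : DualFeasible A s x η γ)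
    (heq : clusterCost A s x ω ξ = ∑ j, ω j * η j - ∑ i, κ i * γ i) :
    ∀ (i : Fin k) (j : Fin n), 0 < ξ i j →
      (η j = ellipNorm (A i) (x j - s i) ^ 2 + γ i ∧
        (∀ l : Fin k, ellipNorm (A i) (x j - s i) ^ 2 + γ i ≤
          ellipNorm (A l) (x j - s l) ^ 2 + γ l) ∧
        x j ∈ APDcell A s γ i) := by
  intro i j hij
  have hnonneg : ∀ i j, 0 ≤ ξ i j * ω j * (ellipNorm (A i) (x j - s i) ^ 2 + γ i - η j) :=
    fun i j => mul_nonneg (mul_nonneg (hξ.1 i j) (hω j).le) (sub_nonneg.2 (hηγ i j))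
  have hgap := hξ.clusterCost_sub_dual_eq_sum_slack A s x η γ
  rw [heq, sub_self, eq_comm,
    Finset.sum_eq_zero_iff_of_nonneg fun i _ => Finset.sum_nonneg fun j _ => hnonneg i j] at hgap
  have hslack := (Finset.sum_eq_zero_iff_of_nonneg fun j _ => hnonneg i j).1
    (hgap i (Finset.mem_univ i)) j (Finset.mem_univ j)
  have hη : η j = ellipNorm (A i) (x j - s i) ^ 2 + γ i :=
    (sub_eq_zero.1 ((mul_eq_zero.1 hslack).resolve_left (mul_pos hij (hω j)).ne')).symm
  have hcell : ∀ l : Fin k, ellipNorm (A i) (x j - s i) ^ 2 + γ i ≤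
      ellipNorm (A l) (x j - s l) ^ 2 + γ l := fun l => hη ▸ hηγ l j
  exact ⟨hη, hcell, hcell⟩
end

section
/- (The unregularized soft-separation objective has infimum 0.) Let x_1,…,x_n ∈ ℝ^d be finitely many points with labels y_1,…,y_n ∈ [k], where each label class is nonempty. Consider all tuples consisting of symmetric positive definite matrices A_1,…,A_k, pairwise distinct sites s_1,…,s_k ∈ ℝ^d, sizes γ_1,…,γ_k ∈ ℝ, and slack variables ζ_1,…,ζ_n ≥ 0 satisfying, for every j ∈ [n] with y_j = i and every ℓ ∈ [k] with ℓ ≠ i, the constraint ‖x_j − s_i‖_{A_i}² + γ_i ≤ ‖x_j − s_ℓ‖_{A_ℓ}² + γ_ℓ + ζ_j. Then the infimum of Σ_{j=1}^n ζ_j over all such feasible tuples equals 0. -/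
open Matrix BigOperators

theorem ellipNorm_smul_one_sq {d : ℕ} {ε : ℝ} (hε : 0 ≤ ε) (v : Fin d → ℝ) :
    ellipNorm (ε • (1 : Matrix (Fin d) (Fin d) ℝ)) v ^ 2 = ε * (v ⬝ᵥ v) := by
  have hv : 0 ≤ v ⬝ᵥ v := dotProduct_self_star_nonneg v
  rw [ellipNorm, smul_mulVec, one_mulVec, dotProduct_smul, smul_eq_mul,
    Real.sq_sqrt (mul_nonneg hε hv)]

/-- (The unregularized soft-separation objective has infimum 0.)  Given labeled points
`x_1,…,x_n ∈ ℝ^d` with labels `y_1,…,y_n ∈ [k]`, each label class nonempty, consider all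
tuples of symmetric positive definite matrices `A_1,…,A_k`, pairwise distinct sites
`s_1,…,s_k`, sizes `γ_1,…,γ_k`, and slacks `ζ_1,…,ζ_n ≥ 0` satisfying, for every `j`
with `y_j = i` and every `ℓ ≠ i`,
`‖x_j − s_i‖_{A_i}² + γ_i ≤ ‖x_j − s_ℓ‖_{A_ℓ}² + γ_ℓ + ζ_j`.
Then the infimum of `Σ_j ζ_j` over all such feasible tuples equals `0`. -/
theorem soft_separation_infimum_zero {d k n : ℕ}
    (x : Fin n → Fin d → ℝ) (y : Fin n → Fin k) (hy : ∀ i, ∃ j, y j = i) :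
    sInf {v : ℝ | ∃ (A : Fin k → Matrix (Fin d) (Fin d) ℝ) (s : Fin k → Fin d → ℝ)
        (γ : Fin k → ℝ) (ζ : Fin n → ℝ),
        (∀ i, (A i).PosDef) ∧ Function.Injective s ∧ (∀ j, 0 ≤ ζ j) ∧
        (∀ (j : Fin n) (l : Fin k), l ≠ y j →
          ellipNorm (A (y j)) (x j - s (y j)) ^ 2 + γ (y j) ≤
            ellipNorm (A l) (x j - s l) ^ 2 + γ l + ζ j) ∧
        v = ∑ j, ζ j} = 0 := by
  refine le_antisymm ?_ (Real.sInf_nonneg ?_)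
  · by_cases hs : ∃ s : Fin k → Fin d → ℝ, Function.Injective s
    · obtain ⟨s, hs⟩ := hs
      have hc (j : Fin n) : 0 ≤ (x j - s (y j)) ⬝ᵥ (x j - s (y j)) :=
        dotProduct_self_star_nonneg _
      set C := ∑ j, (x j - s (y j)) ⬝ᵥ (x j - s (y j)) with hC
      have hC0 : 0 ≤ C := Finset.sum_nonneg fun j _ => hc j
      refine le_of_forall_pos_le_add fun δ hδ => ?_
      have hε : 0 < δ / (C + 1) := by positivity
      refine le_trans (csInf_le ⟨0, ?_⟩ ⟨fun _ => (δ / (C + 1)) • 1, s, 0,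
        fun j => δ / (C + 1) * ((x j - s (y j)) ⬝ᵥ (x j - s (y j))),
        fun _ => Matrix.PosDef.one.smul hε, hs, fun j => mul_nonneg hε.le (hc j), ?_, rfl⟩) ?_
      · rintro _ ⟨_, _, _, ζ, _, _, hζ, _, rfl⟩
        exact Finset.sum_nonneg fun j _ => hζ j
      · intro j l _
        rw [ellipNorm_smul_one_sq hε.le (x j - s (y j))]
        simp only [Pi.zero_apply, add_zero]
        exact le_add_of_nonneg_left (sq_nonneg _)
      · rw [← Finset.mul_sum, ← hC, zero_add, div_mul_eq_mul_div, div_le_iff₀ (by positivity)]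
        nlinarith
    · refine Real.sInf_nonpos ?_
      rintro _ ⟨_, s, _, _, _, hinj, _⟩
      exact absurd ⟨s, hinj⟩ hs
  · rintro _ ⟨_, _, _, ζ, _, _, hζ, _, rfl⟩
    exact Finset.sum_nonneg fun j _ => hζ j
end
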